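/- arXiv:2411.11557 — 2 statements merged into one kernel-verified Lean document; each statement's English description precedes it below -/
import Mathlib

section
/- For every integer k ≥ 2, q(K_1 ∨ ((k−1)P_2 ∪ S_3)) > q(L_2), where L_2 is the graph obtained from K_1 ∨ (kP_2) (with join vertex w) by attaching a pendant path w–u–v of length 2 at w. -/
namespace QPaper

open SimpleGraph

/-- The signless Laplacian matrix `Q(G) = D(G) + A(G)` of a graph, over `ℝ`. -/
noncomputable def signlessLap {V : Type*} [Fintype V] [DecidableEq V] (G : SimpleGraph V) :
    Matrix V V ℝ :=
  letI := Classical.decRel G.Adj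
  G.degMatrix ℝ + G.adjMatrix ℝ

/-- The `Q`-index of a graph: the largest eigenvalue of its signless Laplacian matrix. -/
noncomputable def qIndex {V : Type*} [Fintype V] [DecidableEq V] (G : SimpleGraph V) : ℝ :=
  sSup (spectrum ℝ (signlessLap G))

/-- The number of edges (size) of a graph. -/
noncomputable def numEdges {V : Type*} (G : SimpleGraph V) : ℕ :=
  Nat.card G.edgeSet

/-- The degree of a vertex. -/
noncomputable def deg {V : Type*} (G : SimpleGraph V) (v : V) : ℕ :=
  Nat.card (G.neighborSet v)

/-- A graph is `2` leaves-free if it has at most one vertex of degree one. -/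
def TwoLeavesFree {V : Type*} (G : SimpleGraph V) : Prop :=
  ∀ u v : V, deg G u = 1 → deg G v = 1 → u = v

/-- The maximum degree `Δ(G)`. -/
noncomputable def maxDeg {V : Type*} [Fintype V] (G : SimpleGraph V) : ℕ :=
  letI := Classical.decEq V
  letI := Classical.decRel G.Adj
  G.maxDegree

/-- `k` disjoint copies of `P₂`, i.e. a perfect matching on `2k` vertices. -/
def matching (k : ℕ) : SimpleGraph (Fin k × Fin 2) :=
  SimpleGraph.fromRel (fun a b => a.1 = b.1)

/-- The star graph `Sₙ` on `n` vertices (`K_{1,n-1}` with center `0`). -/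
def starGraph (n : ℕ) : SimpleGraph (Fin n) :=
  SimpleGraph.fromRel (fun a _ => (a : ℕ) = 0)

/-- Disjoint union of two graphs. -/
def dUnion {α β : Type*} (G : SimpleGraph α) (H : SimpleGraph β) : SimpleGraph (α ⊕ β) :=
  SimpleGraph.fromRel (fun a b =>
    (∃ x y, a = Sum.inl x ∧ b = Sum.inl y ∧ G.Adj x y) ∨
    (∃ x y, a = Sum.inr x ∧ b = Sum.inr y ∧ H.Adj x y))

/-- The join `K₁ ∨ H` : a new vertex (`none`) adjacent to every vertex of `H`. -/
def cone {α : Type*} (H : SimpleGraph α) : SimpleGraph (Option α) :=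
  SimpleGraph.fromRel (fun a b =>
    a = none ∨ ∃ x y, a = some x ∧ b = some y ∧ H.Adj x y)

/-- The graph `L₁`: a vertex `w` joined to `k-1` disjoint edges and to three further
vertices `u₁,u₂,u₃`, together with an extra vertex `w'` adjacent to `u₂` and `u₃`. -/
def L1 (k : ℕ) : SimpleGraph ((Option ((Fin (k - 1) × Fin 2) ⊕ Fin 3)) ⊕ Fin 1) :=
  SimpleGraph.fromRel (fun a b =>
    (∃ x y, a = Sum.inl x ∧ b = Sum.inl y ∧
      (cone (dUnion (matching (k - 1)) (⊥ : SimpleGraph (Fin 3)))).Adj x y) ∨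
    (∃ i : Fin 3, (i : ℕ) ≠ 0 ∧ a = Sum.inl (some (Sum.inr i)) ∧ b = Sum.inr 0))

/-- The graph `L₂`: `K₁ ∨ (kP₂)` with a pendant path `w–u–v` attached at the join vertex. -/
def L2 (k : ℕ) : SimpleGraph ((Option (Fin k × Fin 2)) ⊕ Fin 2) :=
  SimpleGraph.fromRel (fun a b =>
    (∃ x y, a = Sum.inl x ∧ b = Sum.inl y ∧ (cone (matching k)).Adj x y) ∨
    (a = Sum.inl none ∧ b = Sum.inr 0) ∨
    (a = Sum.inr 0 ∧ b = Sum.inr 1))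

section

open scoped Matrix

/-- A nonnegative real matrix with a positive supersolution `M x ≤ r x` has all its real
eigenvalues bounded by `r`. -/
theorem le_of_mem_spectrum_of_mulVec_le {V : Type*} [Fintype V] [DecidableEq V]
    {M : Matrix V V ℝ} (hM : ∀ i j, 0 ≤ M i j) {x : V → ℝ} (hx : ∀ i, 0 < x i) {r : ℝ}
    (hr : ∀ i, (M *ᵥ x) i ≤ r * x i) {μ : ℝ} (hμ : μ ∈ spectrum ℝ M) : μ ≤ r := by
  rw [← Matrix.spectrum_toLin', ← Module.End.hasEigenvalue_iff_mem_spectrum] at hμ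
  obtain ⟨y, hy⟩ := hμ.exists_hasEigenvector
  have hy0 := hy.2
  have hMy : M *ᵥ y = μ • y := by simpa using hy.apply_eq_smul
  obtain ⟨j, hj⟩ := Function.ne_iff.1 hy0
  obtain ⟨i, -, hi⟩ := Finset.exists_max_image Finset.univ (fun i => |y i| / x i)
    ⟨j, Finset.mem_univ j⟩
  set m := |y i| / x i with hm
  have hyi : |y i| = m * x i := by rw [hm, div_mul_cancel₀ _ (hx i).ne']
  have hle : ∀ l, |y l| ≤ m * x l := fun l => (div_le_iff₀ (hx l)).1 (hi l (Finset.mem_univ l))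
  have hmpos : 0 < m := lt_of_lt_of_le (div_pos (abs_pos.2 hj) (hx j)) (hi j (Finset.mem_univ j))
  have key : μ * |y i| ≤ r * |y i| := by
    calc μ * |y i| ≤ |μ| * |y i| := by gcongr; exact le_abs_self μ
      _ = |(M *ᵥ y) i| := by rw [hMy, Pi.smul_apply, smul_eq_mul, abs_mul]
      _ ≤ ∑ l, |M i l * y l| := Finset.abs_sum_le_sum_abs _ _
      _ ≤ ∑ l, m * (M i l * x l) := by
        refine Finset.sum_le_sum fun l _ => ?_
        rw [abs_mul, abs_of_nonneg (hM i l), mul_left_comm]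
        exact mul_le_mul_of_nonneg_left (hle l) (hM i l)
      _ = m * (M *ᵥ x) i := by rw [← Finset.mul_sum]; rfl
      _ ≤ m * (r * x i) := by gcongr; exact hr i
      _ = r * |y i| := by rw [hyi]; ring
  exact le_of_mul_le_mul_right key (hyi ▸ mul_pos hmpos (hx i))

open Classical in
theorem signlessLap_mulVec {V : Type*} [Fintype V] [DecidableEq V] (G : SimpleGraph V)
    (x : V → ℝ) (v : V) :
    (signlessLap G *ᵥ x) v = ∑ w, if G.Adj v w then x v + x w else 0 := by
  have h1 : (G.degMatrix ℝ *ᵥ x) v = ∑ w, if G.Adj v w then x v else 0 := by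
    rw [SimpleGraph.degMatrix, Matrix.mulVec_diagonal, ← Finset.sum_filter, Finset.sum_const,
      nsmul_eq_mul, ← SimpleGraph.neighborFinset_eq_filter, SimpleGraph.card_neighborFinset_eq_degree]
  have h2 : (G.adjMatrix ℝ *ᵥ x) v = ∑ w, if G.Adj v w then x w else 0 := by
    rw [SimpleGraph.adjMatrix_mulVec_apply, SimpleGraph.neighborFinset_eq_filter,
      Finset.sum_filter]
  have h : (signlessLap G *ᵥ x) v = (G.degMatrix ℝ *ᵥ x) v + (G.adjMatrix ℝ *ᵥ x) v := by
    rw [signlessLap, Matrix.add_mulVec, Pi.add_apply]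
  rw [h, h1, h2, ← Finset.sum_add_distrib]
  refine Finset.sum_congr rfl fun w _ => ?_
  split_ifs <;> simp

theorem signlessLap_nonneg {V : Type*} [Fintype V] [DecidableEq V] (G : SimpleGraph V)
    (i j : V) : 0 ≤ signlessLap G i j := by
  classical
  rw [signlessLap, Matrix.add_apply, SimpleGraph.degMatrix, Matrix.diagonal_apply,
    SimpleGraph.adjMatrix_apply]
  split_ifs <;> positivity

theorem qIndex_le_of_mulVec_le {V : Type*} [Fintype V] [DecidableEq V] {G : SimpleGraph V}
    {x : V → ℝ} (hx : ∀ i, 0 < x i) {r : ℝ} (hr0 : 0 ≤ r)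
    (hr : ∀ i, (signlessLap G *ᵥ x) i ≤ r * x i) : qIndex G ≤ r :=
  Real.sSup_le (fun _ hμ => le_of_mem_spectrum_of_mulVec_le (signlessLap_nonneg G) hx hr hμ) hr0

theorem le_qIndex_of_mulVec_eq {V : Type*} [Fintype V] [DecidableEq V] {G : SimpleGraph V}
    {x : V → ℝ} (hx : x ≠ 0) {r : ℝ} (hr : ∀ i, (signlessLap G *ᵥ x) i = r * x i) :
    r ≤ qIndex G := by
  refine le_csSup ?_ ?_
  · rw [← Matrix.spectrum_toLin']
    exact (Module.End.finite_spectrum (Matrix.toLin' (signlessLap G))).bddAbove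
  · rw [← Matrix.spectrum_toLin', ← Module.End.hasEigenvalue_iff_mem_spectrum]
    refine Module.End.hasEigenvalue_of_hasEigenvector (x := x)
      (Module.End.hasEigenvector_iff.2 ⟨Module.End.mem_eigenspace_iff.2 ?_, hx⟩)
    ext i
    simpa using hr i

@[simp]
theorem matching_adj {k : ℕ} {a b : Fin k × Fin 2} :
    (matching k).Adj a b ↔ a.1 = b.1 ∧ a.2 ≠ b.2 := by
  rw [matching, SimpleGraph.fromRel_adj, ne_eq, Prod.ext_iff]
  grind

@[simp]
theorem cone_adj_none_none {α : Type*} {H : SimpleGraph α} : ¬(cone H).Adj none none :=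
  (cone H).irrefl

@[simp]
theorem cone_adj_none_some {α : Type*} {H : SimpleGraph α} {x : α} :
    (cone H).Adj none (some x) := by
  simp [cone]

@[simp]
theorem cone_adj_some_none {α : Type*} {H : SimpleGraph α} {x : α} :
    (cone H).Adj (some x) none := by
  simp [cone]

@[simp]
theorem cone_adj_some_some {α : Type*} {H : SimpleGraph α} {x y : α} :
    (cone H).Adj (some x) (some y) ↔ H.Adj x y := by
  simpa [cone, H.adj_comm y x] using H.ne_of_adj

@[simp]
theorem dUnion_adj_inl_inl {α β : Type*} {G : SimpleGraph α} {H : SimpleGraph β} {x y : α} :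
    (dUnion G H).Adj (.inl x) (.inl y) ↔ G.Adj x y := by
  simpa [dUnion, G.adj_comm y x] using G.ne_of_adj

@[simp]
theorem dUnion_adj_inr_inr {α β : Type*} {G : SimpleGraph α} {H : SimpleGraph β} {x y : β} :
    (dUnion G H).Adj (.inr x) (.inr y) ↔ H.Adj x y := by
  simpa [dUnion, H.adj_comm y x] using H.ne_of_adj

@[simp]
theorem dUnion_not_adj_inl_inr {α β : Type*} {G : SimpleGraph α} {H : SimpleGraph β} {x : α}
    {y : β} : ¬(dUnion G H).Adj (.inl x) (.inr y) := by
  simp [dUnion]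

@[simp]
theorem dUnion_not_adj_inr_inl {α β : Type*} {G : SimpleGraph α} {H : SimpleGraph β} {x : α}
    {y : β} : ¬(dUnion G H).Adj (.inr y) (.inl x) := by
  simp [dUnion]

@[simp]
theorem L2_adj_inl_inl {k : ℕ} {x y : Option (Fin k × Fin 2)} :
    (L2 k).Adj (.inl x) (.inl y) ↔ (cone (matching k)).Adj x y := by
  simpa [L2, (cone (matching k)).adj_comm y x] using (cone (matching k)).ne_of_adj

@[simp]
theorem L2_adj_inl_inr {k : ℕ} {x : Option (Fin k × Fin 2)} {j : Fin 2} :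
    (L2 k).Adj (.inl x) (.inr j) ↔ x = none ∧ j = 0 := by
  simp [L2]

@[simp]
theorem L2_adj_inr_inl {k : ℕ} {x : Option (Fin k × Fin 2)} {j : Fin 2} :
    (L2 k).Adj (.inr j) (.inl x) ↔ x = none ∧ j = 0 := by
  rw [SimpleGraph.adj_comm, L2_adj_inl_inr]

@[simp]
theorem L2_adj_inr_inr {k : ℕ} {i j : Fin 2} : (L2 k).Adj (.inr i) (.inr j) ↔ i ≠ j := by
  fin_cases i <;> fin_cases j <;> simp [L2]

theorem qIndex_L2_le {k : ℕ} {q : ℝ} (hq : 4 < q)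
    (h : q = 2 * k + 1 + 2 * k / (q - 3) + (q - 1) / (q ^ 2 - 3 * q + 1)) :
    qIndex (L2 k) ≤ q := by
  have h3 : 0 < q - 3 := by linarith
  have h1 : 0 < q - 1 := by linarith
  have h2 : 0 < q ^ 2 - 3 * q + 1 := by nlinarith
  refine qIndex_le_of_mulVec_le (x := Sum.elim (fun o => o.elim 1 fun _ => 1 / (q - 3))
    ![(q - 1) / (q ^ 2 - 3 * q + 1), 1 / (q ^ 2 - 3 * q + 1)]) ?_ (by linarith) fun v => le_of_eq ?_
  · rintro ((_ | _) | j)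
    · simp
    · simpa using h3
    · fin_cases j <;> simp <;> positivity
  classical
  rw [signlessLap_mulVec]
  rcases v with (_ | ⟨a, b⟩) | j
  · simp
    linear_combination (norm := (field_simp; ring)) -h
  · fin_cases b <;> simp [Fintype.sum_option, Fintype.sum_prod_type] <;> field_simp <;> ring
  · fin_cases j <;> simp <;> field_simp <;> ring

theorem le_qIndex_cone_matching_star {m : ℕ} {q : ℝ} (hq : 4 < q)
    (h : q = 2 * m + 3 + 2 * m / (q - 3) + (3 * q - 4) / ((q - 1) * (q - 4))) :
    q ≤ qIndex (cone (dUnion (matching m) (starGraph 3))) := by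
  have h3 : 0 < q - 3 := by linarith
  have h1 : 0 < q - 1 := by linarith
  have h2 : 0 < q - 4 := by linarith
  refine le_qIndex_of_mulVec_eq (x := fun o => o.elim 1 (Sum.elim (fun _ => 1 / (q - 3))
    ![q / ((q - 1) * (q - 4)), (q - 2) / ((q - 1) * (q - 4)), (q - 2) / ((q - 1) * (q - 4))]))
    ?_ fun v => ?_
  · exact Function.ne_iff.2 ⟨none, one_ne_zero⟩
  classical
  rw [signlessLap_mulVec]
  rcases v with _ | ⟨a, b⟩ | j
  · simp [Fin.sum_univ_three]
    linear_combination (norm := (field_simp; ring)) -h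
  · fin_cases b <;> simp [Fintype.sum_option, Fintype.sum_prod_type] <;> field_simp <;> ring
  · fin_cases j <;> simp [starGraph, Fin.sum_univ_three] <;> field_simp <;> ring

end

theorem stmt11 (k : ℕ) (hk : 2 ≤ k) :
    qIndex (cone (dUnion (matching (k - 1)) (starGraph 3))) > qIndex (L2 k) := by
  obtain ⟨m, rfl⟩ : ∃ m, k = m + 1 := ⟨k - 1, by omega⟩
  have hm : (1 : ℝ) ≤ m := by exact_mod_cast (by omega : 1 ≤ m)
  rw [Nat.add_sub_cancel]
  obtain ⟨r, ⟨hr1, hr2⟩, hr⟩ : ∃ r ∈ Set.Icc (2 * m + 4 : ℝ) (2 * m + 6),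
      r - (2 * (m + 1) + 1 + 2 * (m + 1) / (r - 3) + (r - 1) / (r ^ 2 - 3 * r + 1)) = 0 := by
    refine intermediate_value_Icc (by linarith) ?_ ⟨?_, ?_⟩
    · intro r hr
      have hr1 := hr.1
      have h3 : r - 3 ≠ 0 := by linarith
      have h2 : r ^ 2 - 3 * r + 1 ≠ 0 := by nlinarith
      fun_prop (disch := assumption)
    · have h1 : 1 ≤ 2 * (m + 1 : ℝ) / (2 * m + 4 - 3) := by
        rw [le_div_iff₀ (by linarith)]; linarith
      have h2 : 0 ≤ (2 * m + 4 - 1 : ℝ) / ((2 * m + 4) ^ 2 - 3 * (2 * m + 4) + 1) :=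
        div_nonneg (by linarith) (by nlinarith)
      linarith
    · have h1 : 2 * (m + 1 : ℝ) / (2 * m + 6 - 3) ≤ 1 := by
        rw [div_le_iff₀ (by linarith)]; linarith
      have h2 : (2 * m + 6 - 1 : ℝ) / ((2 * m + 6) ^ 2 - 3 * (2 * m + 6) + 1) ≤ 1 := by
        rw [div_le_iff₀ (by nlinarith)]; nlinarith
      linarith
  have hlt : 2 / (r - 3) + (r - 1) / (r ^ 2 - 3 * r + 1) < (3 * r - 4) / ((r - 1) * (r - 4)) := by
    have h2 : 0 < r ^ 2 - 3 * r + 1 := by nlinarith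
    obtain ⟨t, rfl⟩ : ∃ t, r = t + 6 := ⟨r - 6, by ring⟩
    have ht : 0 ≤ t := by linarith
    rw [div_add_div _ _ (by linarith) h2.ne', div_lt_div_iff₀
      (mul_pos (by linarith) h2) (mul_pos (by linarith) (by linarith)), ← sub_pos]
    ring_nf
    positivity
  obtain ⟨s, ⟨hs1, hs2⟩, hs⟩ : ∃ s ∈ Set.Icc r (2 * m + 8),
      s - (2 * m + 3 + 2 * m / (s - 3) + (3 * s - 4) / ((s - 1) * (s - 4))) = 0 := by
    refine intermediate_value_Icc (by linarith) ?_ ⟨?_, ?_⟩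
    · intro s hs
      have hs1 := hs.1
      have h3 : s - 3 ≠ 0 := by linarith
      have h2 : (s - 1) * (s - 4) ≠ 0 := by nlinarith
      fun_prop (disch := assumption)
    · have : 2 * (m + 1) / (r - 3) = 2 * m / (r - 3) + 2 / (r - 3) := by ring
      linarith
    · have h1 : 2 * (m : ℝ) / (2 * m + 8 - 3) ≤ 1 := by
        rw [div_le_iff₀ (by linarith)]; linarith
      have h2 : (3 * (2 * m + 8) - 4 : ℝ) / ((2 * m + 8 - 1) * (2 * m + 8 - 4)) ≤ 1 := by
        rw [div_le_iff₀ (by nlinarith)]; nlinarith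
      linarith
  have hne : r ≠ s := by
    rintro rfl
    have : 2 * (m + 1) / (r - 3) = 2 * m / (r - 3) + 2 / (r - 3) := by ring
    linarith
  calc qIndex (L2 (m + 1)) ≤ r :=
        qIndex_L2_le (by linarith) (by push_cast; linarith)
    _ < s := lt_of_le_of_ne hs1 hne
    _ ≤ _ := le_qIndex_cone_matching_star (by linarith) (by linarith)

end QPaper
end

section
/- For every integer k ≥ 2, q(K_1 ∨ ((k−2)P_2 ∪ S_4 ∪ P_1)) > 2k + 2 + 1/k. -/
namespace QPaper

open SimpleGraph

/-- The quadratic form `⟨x, Q(G) x⟩` of the signless Laplacian, as a sum over ordered pairs. -/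
noncomputable def signlessForm {V : Type*} [Fintype V] (G : SimpleGraph V) (x : V → ℝ) : ℝ :=
  letI := Classical.decRel G.Adj
  ∑ v, ∑ u, if G.Adj v u then x v * (x v + x u) else 0

lemma dotProduct_signlessLap_mulVec {V : Type*} [Fintype V] [DecidableEq V]
    (G : SimpleGraph V) (x : V → ℝ) :
    x ⬝ᵥ (signlessLap G).mulVec x = signlessForm G x := by
  classical
  simp only [signlessLap, signlessForm, dotProduct, Matrix.add_mulVec, Pi.add_apply,
    degMatrix_mulVec_apply, adjMatrix_mulVec_apply]
  refine Finset.sum_congr rfl fun v _ => ?_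
  rw [← Finset.sum_filter, ← neighborFinset_eq_filter, ← Finset.mul_sum, Finset.sum_add_distrib,
    Finset.sum_const, card_neighborFinset_eq_degree, nsmul_eq_mul]

lemma isHermitian_signlessLap {V : Type*} [Fintype V] [DecidableEq V] (G : SimpleGraph V) :
    (signlessLap G).IsHermitian :=
  letI := Classical.decRel G.Adj
  (G.isHermitian_degMatrix ℝ).add (G.isHermitian_adjMatrix ℝ)

/-- The Rayleigh principle for the `Q`-index. -/
lemma lt_qIndex_of_lt_signlessForm {V : Type*} [Fintype V] [DecidableEq V] (G : SimpleGraph V)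
    (x : V → ℝ) (r : ℝ) (h : r * ∑ v, x v ^ 2 < signlessForm G x) : r < qIndex G := by
  by_contra! hq
  have hpos : (r • (1 : Matrix V V ℝ) - signlessLap G).PosSemidef := by
    rw [Matrix.posSemidef_iff_isHermitian_and_spectrum_nonneg]
    refine ⟨(Matrix.isHermitian_one.smul (IsSelfAdjoint.all r)).sub (isHermitian_signlessLap G),
      fun μ hμ => ?_⟩
    rw [← Algebra.algebraMap_eq_smul_one, ← spectrum.singleton_sub_eq] at hμ
    obtain ⟨_, rfl, ν, hν, rfl⟩ := Set.mem_sub.1 hμ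
    have := le_csSup (Matrix.finite_real_spectrum (A := signlessLap G)).bddAbove hν
    exact sub_nonneg.2 (this.trans hq)
  have key := hpos.dotProduct_mulVec_nonneg x
  rw [star_trivial, Matrix.sub_mulVec, dotProduct_sub, dotProduct_signlessLap_mulVec,
    Matrix.smul_mulVec, Matrix.one_mulVec, dotProduct_smul, smul_eq_mul] at key
  simp only [dotProduct, ← sq] at key
  linarith

lemma signlessForm_dUnion {α β : Type*} [Fintype α] [Fintype β] (G : SimpleGraph α)
    (H : SimpleGraph β) (x : α ⊕ β → ℝ) :
    signlessForm (dUnion G H) x =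
      signlessForm G (fun a => x (Sum.inl a)) + signlessForm H (fun b => x (Sum.inr b)) := by
  have hl (a b : α) : (dUnion G H).Adj (Sum.inl a) (Sum.inl b) ↔ G.Adj a b := by
    simpa [dUnion, G.adj_comm b a] using fun h : G.Adj a b => h.ne
  have hr (a b : β) : (dUnion G H).Adj (Sum.inr a) (Sum.inr b) ↔ H.Adj a b := by
    simpa [dUnion, H.adj_comm b a] using fun h : H.Adj a b => h.ne
  have hlr (a : α) (b : β) : ¬ (dUnion G H).Adj (Sum.inl a) (Sum.inr b) := by simp [dUnion]
  have hrl (a : α) (b : β) : ¬ (dUnion G H).Adj (Sum.inr b) (Sum.inl a) := by simp [dUnion]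
  simp only [signlessForm, Fintype.sum_sum_type, hlr, hrl, if_false, Finset.sum_const_zero,
    Finset.sum_add_distrib, add_zero, zero_add]
  congr 1
  · exact Finset.sum_congr rfl fun a _ => Finset.sum_congr rfl fun b _ => by
      congr 1
      exact propext (hl a b)
  · exact Finset.sum_congr rfl fun a _ => Finset.sum_congr rfl fun b _ => by
      congr 1
      exact propext (hr a b)

lemma signlessForm_cone {α : Type*} [Fintype α] (H : SimpleGraph α) (x : Option α → ℝ) :
    signlessForm (cone H) x =
      ∑ a, (x none + x (some a)) ^ 2 + signlessForm H (fun a => x (some a)) := by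
  have hs (a b : α) : (cone H).Adj (some a) (some b) ↔ H.Adj a b := by
    simpa [cone, H.adj_comm b a] using fun h : H.Adj a b => h.ne
  have hn (a : α) : (cone H).Adj none (some a) := by simp [cone]
  simp only [signlessForm, Fintype.sum_option, hs, hn, (hn _).symm, SimpleGraph.irrefl, if_true,
    if_false, zero_add, Finset.sum_add_distrib, ← add_assoc]
  congr 1
  · rw [← Finset.sum_add_distrib]
    exact Finset.sum_congr rfl fun a _ => by ring
  · exact Finset.sum_congr rfl fun a _ => Finset.sum_congr rfl fun b _ => by
      congr 1
      exact propext (hs a b)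

lemma signlessForm_matching (n : ℕ) (a : ℝ) :
    signlessForm (matching n) (fun _ => a) = n * (4 * a ^ 2) := by
  classical
  have h (v u : Fin n × Fin 2) : (matching n).Adj v u ↔ v.1 = u.1 ∧ v.2 ≠ u.2 := by
    simp only [matching, fromRel_adj, ne_eq, Prod.ext_iff]
    tauto
  simp [signlessForm, h, Fintype.sum_prod_type, ite_and, Fin.sum_univ_two]
  ring

lemma signlessForm_starGraph_four (c l : ℝ) :
    signlessForm (starGraph 4) ![c, l, l, l] = 3 * (c + l) ^ 2 := by
  simp [signlessForm, starGraph, Fin.sum_univ_four]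
  ring

lemma signlessForm_of_subsingleton {V : Type*} [Fintype V] [Subsingleton V] (G : SimpleGraph V)
    (x : V → ℝ) : signlessForm G x = 0 := by
  refine Finset.sum_eq_zero fun v _ => Finset.sum_eq_zero fun u _ => if_neg fun h => ?_
  exact h.ne (Subsingleton.elim v u)

/-- The hub inequality for the vector solving the eigenvalue equation `Q x = q x` at every vertex
but the hub, where `q = 2k + 2 + 1/k`. -/
lemma hub_sum_gt (k : ℝ) (hk : 2 ≤ k) (q : ℝ) (hq : q = 2 * k + 2 + 1 / k) :
    q < 2 * k + 1 + 2 * (k - 2) * (1 / (q - 3)) + 1 / (q - 1) + (q + 1) / ((q - 1) * (q - 5)) +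
      3 * ((q - 3) / ((q - 1) * (q - 5))) := by
  obtain ⟨t, rfl⟩ : ∃ t, k = t + 2 := ⟨k - 2, by ring⟩
  have ht : 0 ≤ t := by linarith
  have h2 : t + 2 ≠ 0 := by positivity
  have h3 : q - 3 = (2 * t ^ 2 + 7 * t + 7) / (t + 2) := by rw [hq]; field_simp; ring
  have h1 : q - 1 = (2 * t ^ 2 + 9 * t + 11) / (t + 2) := by rw [hq]; field_simp; ring
  have h5 : q - 5 = (2 * t ^ 2 + 5 * t + 3) / (t + 2) := by rw [hq]; field_simp; ring
  rw [← sub_pos, h3, h1, h5, hq]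
  have p1 : 0 < 2 * t ^ 2 + 9 * t + 11 := by positivity
  have p3 : 0 < 2 * t ^ 2 + 7 * t + 7 := by positivity
  have p5 : 0 < 2 * t ^ 2 + 5 * t + 3 := by positivity
  field_simp
  ring_nf
  positivity

theorem stmt16 (k : ℕ) (hk : 2 ≤ k) :
    qIndex (cone (dUnion (matching (k - 2)) (dUnion (starGraph 4) (pathGraph 1)))) > 2 * (k : ℝ) + 2 + 1 / (k : ℝ) := by
  have hk' : (2 : ℝ) ≤ k := by exact_mod_cast hk
  obtain ⟨q, hq⟩ : ∃ q, q = 2 * (k : ℝ) + 2 + 1 / k := ⟨_, rfl⟩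
  have hq6 : 6 < q := by
    have : 0 < 1 / (k : ℝ) := by positivity
    linarith
  have hub := hub_sum_gt k hk' q hq
  have h1 : q - 1 ≠ 0 := by linarith
  have h3 : q - 3 ≠ 0 := by linarith
  have h5 : q - 5 ≠ 0 := by linarith
  obtain ⟨a, ha⟩ : ∃ a, a = 1 / (q - 3) := ⟨_, rfl⟩
  obtain ⟨b, hb⟩ : ∃ b, b = 1 / (q - 1) := ⟨_, rfl⟩
  obtain ⟨c, hc⟩ : ∃ c, c = (q + 1) / ((q - 1) * (q - 5)) := ⟨_, rfl⟩
  obtain ⟨l, hl⟩ : ∃ l, l = (q - 3) / ((q - 1) * (q - 5)) := ⟨_, rfl⟩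
  have ea : 1 + 3 * a = q * a := by rw [ha]; field_simp; ring
  have eb : 1 + b = q * b := by rw [hb]; field_simp; ring
  have ec : 1 + 4 * c + 3 * l = q * c := by rw [hc, hl]; field_simp; ring
  have el : 1 + 2 * l + c = q * l := by rw [hc, hl]; field_simp; ring
  rw [← ha, ← hb, ← hc, ← hl] at hub
  rw [gt_iff_lt, ← hq]
  apply lt_qIndex_of_lt_signlessForm _
    (fun v => v.elim 1 (Sum.elim (fun _ => a) (Sum.elim ![c, l, l, l] fun _ => b)))
  rw [signlessForm_cone, signlessForm_dUnion, signlessForm_dUnion]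
  simp only [Option.elim_none, Option.elim_some, Sum.elim_inl, Sum.elim_inr,
    signlessForm_matching, signlessForm_starGraph_four, signlessForm_of_subsingleton,
    Fintype.sum_option, Fintype.sum_sum_type, Finset.sum_const, Finset.card_univ,
    Fintype.card_prod, Fintype.card_fin, nsmul_eq_mul, Fin.sum_univ_four]
  simp only [Matrix.cons_val, Nat.cast_mul, Nat.cast_sub hk, Nat.cast_ofNat, Nat.cast_one]
  linear_combination hub - 2 * (k - 2) * a * ea - b * eb - c * ec - 3 * l * el

end QPaper
end
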